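/- arXiv:2504.19018 — 6 statements merged into one kernel-verified Lean document; each statement's English description precedes it below -/
import Mathlib

section
/- Let p ≥ 1 and N ≥ 1 be integers, Σ and A symmetric positive definite real p×p matrices, and δ ∈ ℝ^p. For λ ≥ 0 set Q_λ = (Σ + 2λA)⁻¹, M_ridge(λ) = N⁻¹ Q_λ Σ Q_λ + 4λ² Q_λ A δ δᵀ A Q_λ, and M_MLE = N⁻¹ Σ⁻¹. Then there exists λ̄ > 0 such that for every λ with 0 < λ < λ̄, the matrix M_MLE − M_ridge(λ) is positive definite. (Theorem 1(2): the generalized ridge MLE strictly improves the first-order MSE of the MLE for all sufficiently small penalty parameters, even when the shrinkage target is misspecified.) -/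
open Matrix

/-- The bilinear form of a real symmetric matrix is symmetric. -/
theorem Matrix.IsHermitian.dotProduct_mulVec_symm {n : Type*} [Fintype n]
    {A : Matrix n n ℝ} (hA : A.IsHermitian) (x y : n → ℝ) :
    y ⬝ᵥ A *ᵥ x = x ⬝ᵥ A *ᵥ y := by
  have hT : Aᵀ = A := by simpa using hA.eq
  rw [dotProduct_mulVec, ← mulVec_transpose, hT, dotProduct_comm]

/-- Cauchy–Schwarz inequality for the form `(x, y) ↦ xᵀ A y` of a positive semidefinite matrix. -/
theorem Matrix.PosSemidef.sq_dotProduct_mulVec_le {n : Type*} [Fintype n]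
    {A : Matrix n n ℝ} (hA : A.PosSemidef) (x y : n → ℝ) :
    (x ⬝ᵥ A *ᵥ y) ^ 2 ≤ (x ⬝ᵥ A *ᵥ x) * (y ⬝ᵥ A *ᵥ y) := by
  have hsymm := hA.isHermitian.dotProduct_mulVec_symm x y
  have hdiscr := discrim_le_zero (a := y ⬝ᵥ A *ᵥ y) (b := 2 * (x ⬝ᵥ A *ᵥ y))
    (c := x ⬝ᵥ A *ᵥ x) fun t => by
      have h := hA.dotProduct_mulVec_nonneg (x + t • y)
      simp only [star_trivial, mulVec_add, mulVec_smul, dotProduct_add, add_dotProduct,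
        dotProduct_smul, smul_dotProduct, smul_eq_mul, hsymm] at h
      linarith
  rw [discrim] at hdiscr
  linarith

/-- A positive definite matrix stays positive definite after subtracting a small multiple of the
rank-one matrix `A δ δᵀ A`. -/
theorem Matrix.PosDef.sub_smul_mul_vecMulVec_mul {n : Type*} [Fintype n]
    {A : Matrix n n ℝ} (hA : A.PosDef) (δ : n → ℝ) {c : ℝ} (hc : 0 ≤ c)
    (hcδ : c * (δ ⬝ᵥ A *ᵥ δ) < 1) :
    (A - c • (A * vecMulVec δ δ * A)).PosDef := by
  have hT : Aᵀ = A := by simpa using hA.isHermitian.eq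
  refine .of_dotProduct_mulVec_pos ?_ fun x hx => ?_
  · rw [IsHermitian, conjTranspose_eq_transpose_of_trivial]
    simp [transpose_mul, transpose_vecMulVec, hT, Matrix.mul_assoc]
  · have hpos : 0 < x ⬝ᵥ A *ᵥ x := by simpa using hA.dotProduct_mulVec_pos hx
    have hcs := hA.posSemidef.sq_dotProduct_mulVec_le x δ
    have hform : x ⬝ᵥ (A * vecMulVec δ δ * A) *ᵥ x = (x ⬝ᵥ A *ᵥ δ) ^ 2 := by
      rw [← mulVec_mulVec, ← mulVec_mulVec, vecMulVec_mulVec,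
        hA.isHermitian.dotProduct_mulVec_symm x δ]
      simp [mulVec_smul, sq]
    rw [star_trivial, sub_mulVec, dotProduct_sub, smul_mulVec, dotProduct_smul, hform, smul_eq_mul]
    nlinarith [mul_le_mul_of_nonneg_left hcs hc, mul_pos hpos (sub_pos.2 hcδ)]

/-- The MSE difference is the conjugate by `(S + t A)⁻¹` of an explicit matrix. -/
theorem Matrix.inv_sub_ridge_eq {n : Type*} [Fintype n] [DecidableEq n]
    {S A B : Matrix n n ℝ} {t a b : ℝ} (hS : IsUnit S) (hP : IsUnit (S + t • A)) :
    a • S⁻¹ - (a • ((S + t • A)⁻¹ * S * (S + t • A)⁻¹) +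
        b • ((S + t • A)⁻¹ * B * (S + t • A)⁻¹)) =
      (S + t • A)⁻¹ * ((2 * a * t) • A + (a * t ^ 2) • (A * S⁻¹ * A) - b • B) *
        (S + t • A)⁻¹ := by
  have hS' := (isUnit_iff_isUnit_det S).1 hS
  have hP' := (isUnit_iff_isUnit_det _).1 hP
  have hexpand : (S + t • A) * S⁻¹ * (S + t • A) =
      S + (2 * t) • A + t ^ 2 • (A * S⁻¹ * A) := by
    simp only [add_mul, mul_add, smul_mul_assoc, mul_smul_comm, mul_nonsing_inv _ hS',
      Matrix.one_mul, Matrix.mul_assoc, nonsing_inv_mul _ hS', Matrix.mul_one]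
    module
  have hinv : S⁻¹ = (S + t • A)⁻¹ * ((S + t • A) * S⁻¹ * (S + t • A)) * (S + t • A)⁻¹ := by
    rw [Matrix.mul_assoc (S + t • A), nonsing_inv_mul_cancel_left _ _ hP',
      mul_nonsing_inv_cancel_right _ _ hP']
  rw [hexpand] at hinv
  generalize (S + t • A)⁻¹ = Q at hinv ⊢
  conv_lhs => rw [hinv]
  have hmiddle : (2 * a * t) • A + (a * t ^ 2) • (A * S⁻¹ * A) - b • B =
      a • (S + (2 * t) • A + t ^ 2 • (A * S⁻¹ * A)) - (a • S + b • B) := by module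
  rw [hmiddle]
  simp only [mul_sub, sub_mul, mul_add, add_mul, smul_mul_assoc, mul_smul_comm]

/-- Theorem 1(2): for all sufficiently small penalties λ > 0, the first-order MSE
of the generalized ridge MLE, `M_ridge(λ) = N⁻¹ Q_λ Σ Q_λ + 4λ² Q_λ A δ δᵀ A Q_λ`
with `Q_λ = (Σ + 2λA)⁻¹`, is strictly dominated by the first-order MSE of the MLE,
`M_MLE = N⁻¹ Σ⁻¹`, in the sense that the difference is positive definite. -/
theorem ridge_improves_firstOrder_MSE
    (p N : ℕ) (hp : 1 ≤ p) (hN : 1 ≤ N)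
    (Sg A : Matrix (Fin p) (Fin p) ℝ) (hSg : Sg.PosDef) (hA : A.PosDef)
    (δ : Fin p → ℝ)
    (Q : ℝ → Matrix (Fin p) (Fin p) ℝ)
    (hQ : ∀ lam : ℝ, Q lam = (Sg + (2 * lam) • A)⁻¹)
    (Mridge : ℝ → Matrix (Fin p) (Fin p) ℝ)
    (hMridge : ∀ lam : ℝ,
      Mridge lam =
        (N : ℝ)⁻¹ • (Q lam * Sg * Q lam) +
          (4 * lam ^ 2) • (Q lam * A * vecMulVec δ δ * A * Q lam))
    (MMLE : Matrix (Fin p) (Fin p) ℝ) (hMMLE : MMLE = (N : ℝ)⁻¹ • Sg⁻¹) :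
    ∃ lamBar : ℝ, 0 < lamBar ∧
      ∀ lam : ℝ, 0 < lam → lam < lamBar → (MMLE - Mridge lam).PosDef := by
  have hN0 : (0 : ℝ) < N := by exact_mod_cast hN
  have hδ : 0 ≤ δ ⬝ᵥ A *ᵥ δ := by simpa using hA.posSemidef.dotProduct_mulVec_nonneg δ
  refine ⟨(N * (1 + δ ⬝ᵥ A *ᵥ δ))⁻¹, by positivity, fun lam hlam hlt => ?_⟩
  have hsmall : lam * N * (δ ⬝ᵥ A *ᵥ δ) < 1 := by
    rw [← one_div, lt_div_iff₀ (by positivity)] at hlt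
    nlinarith [mul_pos hlam hN0]
  have hP : (Sg + (2 * lam) • A).PosDef := hSg.add (hA.smul (by positivity))
  have hassoc : Q lam * A * vecMulVec δ δ * A * Q lam =
      Q lam * (A * vecMulVec δ δ * A) * Q lam := by simp only [Matrix.mul_assoc]
  have hpd : ((4 * lam / N) • (A - (lam * N) • (A * vecMulVec δ δ * A)) +
      (4 * lam ^ 2 / N) • (A * Sg⁻¹ * A)).PosDef := by
    refine ((hA.sub_smul_mul_vecMulVec_mul δ (by positivity) hsmall).smul
      (by positivity)).add_posSemidef (.smul ?_ (by positivity))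
    simpa only [hA.isHermitian.eq] using hSg.inv.posSemidef.mul_mul_conjTranspose_same A
  rw [hMMLE, hMridge, hassoc, hQ, inv_sub_ridge_eq hSg.isUnit hP.isUnit]
  have hmiddle : (2 * (N : ℝ)⁻¹ * (2 * lam)) • A +
      ((N : ℝ)⁻¹ * (2 * lam) ^ 2) • (A * Sg⁻¹ * A) -
        (4 * lam ^ 2) • (A * vecMulVec δ δ * A) =
      (4 * lam / N) • (A - (lam * N) • (A * vecMulVec δ δ * A)) +
        (4 * lam ^ 2 / N) • (A * Sg⁻¹ * A) := by
    match_scalars <;> field_simp <;> ring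
  rw [hmiddle]
  have hQunit : IsUnit (Sg + (2 * lam) • A)⁻¹ := hP.inv.isUnit
  have hQstar : star (Sg + (2 * lam) • A)⁻¹ = (Sg + (2 * lam) • A)⁻¹ := hP.inv.isHermitian.eq
  simpa only [hQstar] using hQunit.posDef_star_right_conjugate_iff.2 hpd
end

section
/- Let p ≥ 1 and N ≥ 1 be integers, Σ and A symmetric positive definite real p×p matrices, and δ ∈ ℝ^p with δ ≠ 0. For λ ≥ 0 set Q_λ = (Σ + 2λA)⁻¹, M_ridge(λ) = N⁻¹ Q_λ Σ Q_λ + 4λ² Q_λ A δ δᵀ A Q_λ, and M_MLE = N⁻¹ Σ⁻¹. If 0 < λ ≤ ι_min(A) / (N · δᵀA²δ), where ι_min(A) is the smallest eigenvalue of A, then M_MLE − M_ridge(λ) is positive definite. (Quantitative form of Theorem 1(2), Remark 1: any penalty below the explicit threshold ι_min(Λ'Λ)/(N (θ₀−θ_H)'Λ'ΛΛ'Λ(θ₀−θ_H)) yields a strict first-order MSE improvement.) -/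
open Matrix

/-- The quadratic form of a Hermitian real matrix dominates its smallest eigenvalue. -/
theorem Matrix.IsHermitian.iInf_eigenvalues_mul_le {n : Type*} [Fintype n] [DecidableEq n]
    {A : Matrix n n ℝ} (hA : A.IsHermitian) (x : n → ℝ) :
    (⨅ i, hA.eigenvalues i) * (x ⬝ᵥ x) ≤ x ⬝ᵥ A *ᵥ x := by
  set c := ⨅ i, hA.eigenvalues i
  have hB : (A - algebraMap ℝ (Matrix n n ℝ) c).IsHermitian := by
    refine hA.sub ?_
    rw [Algebra.algebraMap_eq_smul_one]
    simp [IsHermitian]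
  have hpsd : (A - algebraMap ℝ (Matrix n n ℝ) c).PosSemidef := by
    rw [hB.posSemidef_iff_eigenvalues_nonneg]
    intro i
    have hmem := hB.eigenvalues_mem_spectrum_real i
    rw [← spectrum.sub_singleton_eq, hA.spectrum_real_eq_range_eigenvalues] at hmem
    obtain ⟨_, ⟨j, rfl⟩, _, rfl, h⟩ := hmem
    have hj : c ≤ hA.eigenvalues j := ciInf_le (Set.finite_range _).bddBelow j
    simp only [Pi.zero_apply, ← h]
    linarith
  have h := hpsd.dotProduct_mulVec_nonneg x
  rw [Algebra.algebraMap_eq_smul_one, sub_mulVec, smul_mulVec, one_mulVec, dotProduct_sub,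
    dotProduct_smul, star_trivial, smul_eq_mul] at h
  linarith

/-- Cauchy–Schwarz for the dot product of real vectors. -/
theorem Matrix.dotProduct_sq_le {n : Type*} [Fintype n] (x y : n → ℝ) :
    (x ⬝ᵥ y) ^ 2 ≤ (x ⬝ᵥ x) * (y ⬝ᵥ y) := by
  simpa only [dotProduct, sq] using Finset.sum_mul_sq_le_sq_mul_sq Finset.univ x y

/-- A multiple of the rank-one matrix `v vᵀ` is dominated by `A` when the factor times `vᵀv` is at
most the smallest eigenvalue of `A`. -/
theorem Matrix.IsHermitian.posSemidef_sub_smul_vecMulVec {n : Type*} [Fintype n] [DecidableEq n]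
    {A : Matrix n n ℝ} (hA : A.IsHermitian) {c : ℝ} (hc : 0 ≤ c) {v : n → ℝ}
    (h : c * (v ⬝ᵥ v) ≤ ⨅ i, hA.eigenvalues i) :
    (A - c • vecMulVec v v).PosSemidef := by
  refine .of_dotProduct_mulVec_nonneg (hA.sub ?_) fun x => ?_
  · simp [IsHermitian]
  · have hx : 0 ≤ x ⬝ᵥ x := by simpa using dotProduct_star_self_nonneg x
    have key : c * (x ⬝ᵥ v) ^ 2 ≤ x ⬝ᵥ A *ᵥ x :=
      calc c * (x ⬝ᵥ v) ^ 2 ≤ c * ((x ⬝ᵥ x) * (v ⬝ᵥ v)) := by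
            gcongr
            exact dotProduct_sq_le x v
        _ = (c * (v ⬝ᵥ v)) * (x ⬝ᵥ x) := by ring
        _ ≤ (⨅ i, hA.eigenvalues i) * (x ⬝ᵥ x) := by gcongr
        _ ≤ _ := hA.iInf_eigenvalues_mul_le x
    have hsq : x ⬝ᵥ vecMulVec v v *ᵥ x = (x ⬝ᵥ v) ^ 2 := by
      rw [vecMulVec_mulVec, op_smul_eq_smul, dotProduct_smul, smul_eq_mul, dotProduct_comm v x, sq]
    rw [star_trivial, sub_mulVec, smul_mulVec, dotProduct_sub, dotProduct_smul, hsq, smul_eq_mul]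
    linarith

/-- Quantitative form of Theorem 1(2) / Remark 1: if
`0 < λ ≤ ι_min(A) / (N · δᵀA²δ)`, where `ι_min(A)` is the smallest eigenvalue of the
symmetric positive definite penalty matrix `A`, then the difference
`M_MLE − M_ridge(λ)` between the first-order MSE of the MLE and that of the
generalized ridge MLE is positive definite. -/
theorem ridge_improves_below_explicit_threshold
    (p N : ℕ) (hp : 1 ≤ p) (hN : 1 ≤ N)
    (Sg A : Matrix (Fin p) (Fin p) ℝ) (hSg : Sg.PosDef) (hA : A.PosDef)
    (δ : Fin p → ℝ) (hδ : δ ≠ 0)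
    (iotaMin : ℝ) (hiota : iotaMin = ⨅ i, hA.1.eigenvalues i)
    (Q : ℝ → Matrix (Fin p) (Fin p) ℝ)
    (hQ : ∀ lam : ℝ, Q lam = (Sg + (2 * lam) • A)⁻¹)
    (Mridge : ℝ → Matrix (Fin p) (Fin p) ℝ)
    (hMridge : ∀ lam : ℝ,
      Mridge lam =
        (N : ℝ)⁻¹ • (Q lam * Sg * Q lam) +
          (4 * lam ^ 2) • (Q lam * A * vecMulVec δ δ * A * Q lam))
    (MMLE : Matrix (Fin p) (Fin p) ℝ) (hMMLE : MMLE = (N : ℝ)⁻¹ • Sg⁻¹)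
    (lam : ℝ) (hlam0 : 0 < lam)
    (hlam : lam ≤ iotaMin / ((N : ℝ) * (δ ⬝ᵥ (A * A).mulVec δ))) :
    (MMLE - Mridge lam).PosDef := by
  have hN0 : (0 : ℝ) < N := by exact_mod_cast hN
  have hAt : Aᵀ = A := by simpa [conjTranspose_eq_transpose_of_trivial] using hA.1.eq
  have hAδ : A *ᵥ δ ≠ 0 := fun h =>
    hδ (mulVec_injective_of_isUnit hA.isUnit (by rw [h, mulVec_zero]))
  have hnorm : δ ⬝ᵥ (A * A) *ᵥ δ = (A *ᵥ δ) ⬝ᵥ (A *ᵥ δ) := by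
    rw [← mulVec_mulVec, dotProduct_mulVec, ← mulVec_transpose, hAt]
  have hpos : 0 < (A *ᵥ δ) ⬝ᵥ (A *ᵥ δ) := by
    simpa using dotProduct_star_self_pos_iff.mpr hAδ
  rw [hnorm, le_div_iff₀ (by positivity), hiota] at hlam
  have hrank : A * vecMulVec δ δ * A = vecMulVec (A *ᵥ δ) (A *ᵥ δ) := by
    rw [mul_vecMulVec, vecMulVec_mul, ← mulVec_transpose, hAt]
  have hpsd : (A - (N * lam) • (A * vecMulVec δ δ * A)).PosSemidef := by
    rw [hrank]
    exact hA.1.posSemidef_sub_smul_vecMulVec (by positivity) (by linarith)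
  have hsand : (A * Sg⁻¹ * A).PosDef := by
    have h := (IsUnit.posDef_star_left_conjugate_iff hA.isUnit).mpr hSg.inv
    rwa [star_eq_conjTranspose, hA.1.eq] at h
  have hW : (Sg + (2 * lam) • A).PosDef := hSg.add (hA.smul (by positivity))
  have hmid : ((4 * lam / N) • ((A - (N * lam) • (A * vecMulVec δ δ * A)) +
      lam • (A * Sg⁻¹ * A))).PosDef :=
    (PosDef.posSemidef_add hpsd (hsand.smul hlam0)).smul (by positivity)
  have hconj := (IsUnit.posDef_star_left_conjugate_iff hW.inv.isUnit).mpr hmid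
  rw [star_eq_conjTranspose, hW.inv.1.eq] at hconj
  convert hconj using 1
  rw [hMMLE, hMridge, hQ]
  set W := Sg + (2 * lam) • A with hWdef
  have hS1 : Sg * Sg⁻¹ = 1 := mul_nonsing_inv _ ((isUnit_iff_isUnit_det _).mp hSg.isUnit)
  have hS2 : Sg⁻¹ * Sg = 1 := nonsing_inv_mul _ ((isUnit_iff_isUnit_det _).mp hSg.isUnit)
  have hW1 : W * W⁻¹ = 1 := mul_nonsing_inv _ ((isUnit_iff_isUnit_det _).mp hW.isUnit)
  have hW2 : W⁻¹ * W = 1 := nonsing_inv_mul _ ((isUnit_iff_isUnit_det _).mp hW.isUnit)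
  have hexp : W * Sg⁻¹ * W = Sg + (4 * lam) • A + (4 * lam ^ 2) • (A * Sg⁻¹ * A) := by
    rw [hWdef]
    simp only [add_mul, mul_add, smul_mul_assoc, mul_smul_comm, hS1, one_mul, mul_assoc, hS2,
      mul_one]
    module
  have hinv : Sg⁻¹ = W⁻¹ * (W * Sg⁻¹ * W) * W⁻¹ := by
    rw [mul_assoc W, ← mul_assoc W⁻¹, hW2, one_mul, mul_assoc, hW1, mul_one]
  nth_rewrite 1 [hinv]
  rw [hexp]
  simp only [mul_add, add_mul, mul_sub, sub_mul, smul_mul_assoc, mul_smul_comm, smul_add, smul_sub,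
    smul_smul, mul_assoc]
  match_scalars <;> field_simp <;> ring
end

section
/- Let p ≥ 1 and N ≥ 1 be integers and Σ, A symmetric positive definite real p×p matrices. Then for every λ > 0, the matrix N⁻¹ Σ⁻¹ − N⁻¹ (Σ + 2λA)⁻¹ Σ (Σ + 2λA)⁻¹ is positive definite. (Correct-target case of Theorem 1: when the shrinkage target equals the true parameter, i.e. δ = θ₀ − θ_H = 0, the first-order MSE improvement of the generalized ridge MLE over the MLE holds for every positive penalty parameter λ.) -/
open Matrix

/-- If `S` and `S + B` are invertible, then `S⁻¹ - (S + B)⁻¹ S (S + B)⁻¹` is the congruence of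
`B + B + B S⁻¹ B` by `(S + B)⁻¹`. -/
lemma inv_sub_inv_add_mul_mul_inv_add {n R : Type*} [Fintype n] [DecidableEq n] [CommRing R]
    {S B : Matrix n n R} (hS : IsUnit S) (hM : IsUnit (S + B)) :
    S⁻¹ - (S + B)⁻¹ * S * (S + B)⁻¹ =
      (S + B)⁻¹ * (B + B + B * S⁻¹ * B) * (S + B)⁻¹ := by
  have hS_det := (Matrix.isUnit_iff_isUnit_det S).mp hS
  have hM_det := (Matrix.isUnit_iff_isUnit_det (S + B)).mp hM
  have expand : B + B + B * S⁻¹ * B = (S + B) * S⁻¹ * (S + B) - S := by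
    rw [add_mul, Matrix.mul_nonsing_inv _ hS_det, add_mul, one_mul, mul_add,
      Matrix.nonsing_inv_mul_cancel_right _ _ hS_det]
    abel
  rw [expand, mul_sub, sub_mul, mul_assoc (S + B), Matrix.nonsing_inv_mul_cancel_left _ _ hM_det,
    Matrix.mul_nonsing_inv_cancel_right _ _ hM_det]

/-- For positive definite `S` and `B`, the matrix `S⁻¹ - (S + B)⁻¹ S (S + B)⁻¹` is positive
definite. -/
lemma Matrix.PosDef.inv_sub_inv_add_mul_mul_inv_add {n : Type*} [Fintype n] [DecidableEq n]
    {S B : Matrix n n ℝ} (hS : S.PosDef) (hB : B.PosDef) :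
    (S⁻¹ - (S + B)⁻¹ * S * (S + B)⁻¹).PosDef := by
  have hM : (S + B).PosDef := hS.add hB
  have hBSB : (B * S⁻¹ * B).PosSemidef := by
    simpa only [hB.isHermitian.eq] using hS.inv.posSemidef.mul_mul_conjTranspose_same B
  rw [_root_.inv_sub_inv_add_mul_mul_inv_add hS.isUnit hM.isUnit]
  have hcongr := ((hB.add hB).add_posSemidef hBSB).mul_mul_conjTranspose_same
    (Matrix.vecMul_injective_of_isUnit hM.inv.isUnit)
  rwa [hM.inv.isHermitian.eq] at hcongr

/-- Correct-target case of Theorem 1: when the shrinkage target equals the true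
parameter (δ = 0), for every λ > 0 the matrix
`N⁻¹ Σ⁻¹ − N⁻¹ (Σ + 2λA)⁻¹ Σ (Σ + 2λA)⁻¹` is positive definite. -/
theorem ridge_improves_correct_target
    (p N : ℕ) (hp : 1 ≤ p) (hN : 1 ≤ N)
    (Sg A : Matrix (Fin p) (Fin p) ℝ) (hSg : Sg.PosDef) (hA : A.PosDef) :
    ∀ lam : ℝ, 0 < lam →
      ((N : ℝ)⁻¹ • Sg⁻¹ -
        (N : ℝ)⁻¹ • ((Sg + (2 * lam) • A)⁻¹ * Sg * (Sg + (2 * lam) • A)⁻¹)).PosDef := by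
  intro lam hlam
  have hN_inv : (0 : ℝ) < (N : ℝ)⁻¹ := inv_pos.mpr (by exact_mod_cast hN)
  rw [← smul_sub]
  exact (hSg.inv_sub_inv_add_mul_mul_inv_add (hA.smul (by positivity))).smul hN_inv
end

section
/- Let p ≥ 1 and N ≥ 1 be integers, Σ a symmetric positive definite real p×p matrix, and δ ∈ ℝ^p. Set v = trace(Σ⁻¹)/N and, for λ ≥ 0, Q_λ = (Σ + 2λΣ)⁻¹ and D(λ) = N⁻¹Σ⁻¹ − [N⁻¹ Q_λ Σ Q_λ + 4λ² Q_λ Σ δ δᵀ Σ Q_λ]. If ‖δ‖² > v, then for every λ with 0 < λ < v/(‖δ‖² − v), trace(D(λ)) > 0. (Proposition 1(i): with Hessian-based weighting Λ = E(−H₁)^{1/2}, so that the penalty matrix is A = Σ, the trace of the first-order MSE difference is strictly positive on an explicit interval of penalties when the target misspecification exceeds the MLE risk v.) -/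
open Matrix

/-- Proposition 1(i): with Hessian-based weighting (penalty matrix `A = Σ`), if the
target misspecification `‖δ‖²` exceeds the MLE risk `v = trace(Σ⁻¹)/N`, then for every
penalty `0 < λ < v/(‖δ‖² − v)` the trace of the first-order MSE difference
`D(λ) = N⁻¹Σ⁻¹ − [N⁻¹ Q_λ Σ Q_λ + 4λ² Q_λ Σ δδᵀ Σ Q_λ]`, with `Q_λ = (Σ + 2λΣ)⁻¹`,
is strictly positive. -/
theorem ridge_trace_improvement_misspecified_target
    (p N : ℕ) (hp : 1 ≤ p) (hN : 1 ≤ N)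
    (Sg : Matrix (Fin p) (Fin p) ℝ) (hSg : Sg.PosDef)
    (δ : EuclideanSpace ℝ (Fin p))
    (v : ℝ) (hv : v = Sg⁻¹.trace / N)
    (Q : ℝ → Matrix (Fin p) (Fin p) ℝ)
    (hQ : ∀ lam : ℝ, Q lam = (Sg + (2 * lam) • Sg)⁻¹)
    (D : ℝ → Matrix (Fin p) (Fin p) ℝ)
    (hD : ∀ lam : ℝ,
      D lam =
        (N : ℝ)⁻¹ • Sg⁻¹ -
          ((N : ℝ)⁻¹ • (Q lam * Sg * Q lam) +
            (4 * lam ^ 2) • (Q lam * Sg * vecMulVec δ δ * Sg * Q lam)))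
    (hmis : v < ‖δ‖ ^ 2) :
    ∀ lam : ℝ, 0 < lam → lam < v / (‖δ‖ ^ 2 - v) → 0 < (D lam).trace := by
  intro lam hlam hlt
  have hdet : IsUnit Sg.det := (Matrix.isUnit_iff_isUnit_det _).mp hSg.isUnit
  have hc : (1 + 2 * lam) ≠ 0 := by positivity
  have hQ' : Q lam = (1 + 2 * lam)⁻¹ • Sg⁻¹ := by
    rw [hQ]
    refine Matrix.inv_eq_left_inv ?_
    rw [show Sg + (2 * lam) • Sg = (1 + 2 * lam) • Sg by rw [add_smul, one_smul],
      smul_mul_smul_comm, inv_mul_cancel₀ hc, Matrix.nonsing_inv_mul _ hdet,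
      one_smul]
  have hvar : Q lam * Sg * Q lam = ((1 + 2 * lam) ^ 2)⁻¹ • Sg⁻¹ := by
    rw [hQ', smul_mul_assoc, Matrix.nonsing_inv_mul _ hdet, smul_mul_smul_comm, one_mul,
      ← mul_inv, ← sq]
  have hbias : Q lam * Sg * vecMulVec δ δ * Sg * Q lam
      = ((1 + 2 * lam) ^ 2)⁻¹ • vecMulVec δ δ := by
    rw [hQ', smul_mul_assoc, Matrix.nonsing_inv_mul _ hdet, mul_assoc _ Sg, mul_smul_comm,
      Matrix.mul_nonsing_inv _ hdet, smul_mul_assoc, one_mul, smul_mul_smul_comm, mul_one,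
      ← mul_inv, ← sq]
  have hnorm : (vecMulVec δ δ).trace = ‖δ‖ ^ 2 := by
    rw [EuclideanSpace.real_norm_sq_eq, Matrix.trace_vecMulVec]
    simp [dotProduct, sq]
  have htrace : (D lam).trace
      = 4 * lam * (v - lam * (‖δ‖ ^ 2 - v)) / (1 + 2 * lam) ^ 2 := by
    rw [hD, hvar, hbias]
    simp only [Matrix.trace_sub, Matrix.trace_add, Matrix.trace_smul, smul_eq_mul, hnorm]
    have hN' : (N : ℝ) ≠ 0 := by positivity
    rw [hv]
    field_simp
    ring
  rw [lt_div_iff₀ (sub_pos.mpr hmis)] at hlt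
  rw [htrace]
  have := sub_pos.mpr hlt
  positivity
end

section
/- Let p ≥ 1 and N ≥ 1 be integers, Σ a symmetric positive definite real p×p matrix, and δ ∈ ℝ^p. Set v = trace(Σ⁻¹)/N and, for λ ≥ 0, Q_λ = (Σ + 2λΣ)⁻¹ and D(λ) = N⁻¹Σ⁻¹ − [N⁻¹ Q_λ Σ Q_λ + 4λ² Q_λ Σ δ δᵀ Σ Q_λ]. If ‖δ‖² ≤ v, then trace(D(λ)) > 0 for every λ > 0. (Proposition 1(ii): with Hessian-based weighting so that the penalty matrix is A = Σ, the trace of the first-order MSE difference is strictly positive for all positive penalties when the target misspecification does not exceed the MLE risk v.) -/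
open Matrix

/-- Proposition 1(ii): with Hessian-based weighting (penalty matrix `A = Σ`), if the
target misspecification `‖δ‖²` does not exceed the MLE risk `v = trace(Σ⁻¹)/N`, then
the trace of the first-order MSE difference
`D(λ) = N⁻¹Σ⁻¹ − [N⁻¹ Q_λ Σ Q_λ + 4λ² Q_λ Σ δδᵀ Σ Q_λ]`, with `Q_λ = (Σ + 2λΣ)⁻¹`,
is strictly positive for every λ > 0. -/
theorem ridge_trace_improvement_all_lambda
    (p N : ℕ) (hp : 1 ≤ p) (hN : 1 ≤ N)
    (Sg : Matrix (Fin p) (Fin p) ℝ) (hSg : Sg.PosDef)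
    (δ : EuclideanSpace ℝ (Fin p))
    (v : ℝ) (hv : v = Sg⁻¹.trace / N)
    (Q : ℝ → Matrix (Fin p) (Fin p) ℝ)
    (hQ : ∀ lam : ℝ, Q lam = (Sg + (2 * lam) • Sg)⁻¹)
    (D : ℝ → Matrix (Fin p) (Fin p) ℝ)
    (hD : ∀ lam : ℝ,
      D lam =
        (N : ℝ)⁻¹ • Sg⁻¹ -
          ((N : ℝ)⁻¹ • (Q lam * Sg * Q lam) +
            (4 * lam ^ 2) • (Q lam * Sg * vecMulVec δ δ * Sg * Q lam)))
    (hmis : ‖δ‖ ^ 2 ≤ v) :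
    ∀ lam : ℝ, 0 < lam → 0 < (D lam).trace := by
  intro lam hlam
  have : Nonempty (Fin p) := ⟨⟨0, hp⟩⟩
  have hNpos : (0 : ℝ) < N := by exact_mod_cast hN
  have hdet : IsUnit Sg.det := hSg.det_pos.ne'.isUnit
  have hc : 0 < 1 + 2 * lam := by positivity
  have hvpos : 0 < v := hv ▸ div_pos hSg.inv.trace_pos hNpos
  have hQinv : Q lam = (1 + 2 * lam)⁻¹ • Sg⁻¹ := by
    rw [hQ]
    refine inv_eq_right_inv ?_
    rw [show Sg + (2 * lam) • Sg = (1 + 2 * lam) • Sg by rw [add_smul, one_smul],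
      smul_mul_smul_comm, mul_inv_cancel₀ hc.ne', mul_nonsing_inv _ hdet, one_smul]
  have hQS : Q lam * Sg = (1 + 2 * lam)⁻¹ • (1 : Matrix (Fin p) (Fin p) ℝ) := by
    rw [hQinv, smul_mul_assoc, nonsing_inv_mul _ hdet]
  have hSQ : Sg * Q lam = (1 + 2 * lam)⁻¹ • (1 : Matrix (Fin p) (Fin p) ℝ) := by
    rw [hQinv, mul_smul_comm, mul_nonsing_inv _ hdet]
  have hδ : (vecMulVec δ δ).trace = ‖δ‖ ^ 2 := by
    rw [EuclideanSpace.real_norm_sq_eq, trace_vecMulVec]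
    simp only [dotProduct, sq]
  have htrace : (D lam).trace =
      (4 * lam * v + 4 * lam ^ 2 * (v - ‖δ‖ ^ 2)) / (1 + 2 * lam) ^ 2 := by
    rw [hD, Matrix.mul_assoc (Q lam * Sg * vecMulVec δ δ), hSQ, hQS, hQinv]
    simp only [trace_sub, trace_add, trace_smul, smul_mul_assoc, mul_smul_comm, one_mul,
      mul_one, hδ, smul_eq_mul]
    rw [hv]
    field_simp
    ring
  rw [htrace]
  have := sub_nonneg.2 hmis
  positivity
end

section
/- Let p ≥ 1 and N ≥ 1 be integers, Σ an invertible symmetric real p×p matrix, A a symmetric real p×p matrix, δ ∈ ℝ^p, and λ ≥ 0 such that Σ + 2λA is invertible; set Q_λ = (Σ + 2λA)⁻¹. Then N⁻¹ Σ⁻¹ − [N⁻¹ Q_λ Σ Q_λ + 4λ² Q_λ A δ δᵀ A Q_λ] = Q_λ [ (4λ/N) A + (4λ²/N) A Σ⁻¹ A − 4λ² A δ δᵀ A ] Q_λ. (Key factorization of the first-order MSE difference between the MLE and the generalized ridge MLE used in the proof of Theorem 1: the difference is positive definite if and only if the inner bracket is.) -/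
open Matrix

/-- Sandwiching the expansion of `(S + tA) S⁻¹ (S + tA)` between two copies of `(S + tA)⁻¹`
recovers `S⁻¹`. -/
theorem Matrix.inv_eq_inv_add_smul_mul_mul {n R : Type*} [Fintype n] [DecidableEq n] [CommRing R]
    (S A : Matrix n n R) (t : R) (hS : IsUnit S.det) (hM : IsUnit (S + t • A).det) :
    S⁻¹ = (S + t • A)⁻¹ * (S + (2 * t) • A + t ^ 2 • (A * S⁻¹ * A)) * (S + t • A)⁻¹ := by
  have expand : (S + t • A) * S⁻¹ * (S + t • A)
      = S + (2 * t) • A + t ^ 2 • (A * S⁻¹ * A) := by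
    simp only [add_mul, mul_add, smul_mul_assoc, mul_smul_comm, mul_nonsing_inv _ hS,
      nonsing_inv_mul_cancel_right _ _ hS, one_mul]
    module
  rw [← expand, mul_assoc _ S⁻¹, nonsing_inv_mul_cancel_left _ _ hM,
    mul_nonsing_inv_cancel_right _ _ hM]

/-- Key factorization of the first-order MSE difference between the MLE and the
generalized ridge MLE (proof of Theorem 1):
`N⁻¹Σ⁻¹ − [N⁻¹ Q_λ Σ Q_λ + 4λ² Q_λ A δδᵀ A Q_λ]
  = Q_λ [(4λ/N) A + (4λ²/N) A Σ⁻¹ A − 4λ² A δδᵀ A] Q_λ` with `Q_λ = (Σ + 2λA)⁻¹`. -/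
theorem MSE_difference_factorization
    (p N : ℕ) (hp : 1 ≤ p) (hN : 1 ≤ N)
    (Sg A : Matrix (Fin p) (Fin p) ℝ)
    (hSg : IsUnit Sg.det) (hSgSym : Sg.IsHermitian) (hASym : A.IsHermitian)
    (δ : Fin p → ℝ) (lam : ℝ) (hlam : 0 ≤ lam)
    (hinv : IsUnit (Sg + (2 * lam) • A).det)
    (Q : Matrix (Fin p) (Fin p) ℝ) (hQ : Q = (Sg + (2 * lam) • A)⁻¹) :
    (N : ℝ)⁻¹ • Sg⁻¹ -
        ((N : ℝ)⁻¹ • (Q * Sg * Q) + (4 * lam ^ 2) • (Q * A * vecMulVec δ δ * A * Q))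
      = Q *
          ((4 * lam / N) • A + (4 * lam ^ 2 / N) • (A * Sg⁻¹ * A) -
            (4 * lam ^ 2) • (A * vecMulVec δ δ * A)) *
          Q := by
  have h := Matrix.inv_eq_inv_add_smul_mul_mul Sg A (2 * lam) hSg hinv
  rw [← hQ] at h
  nth_rewrite 1 [h]
  simp only [mul_add, add_mul, mul_sub, sub_mul, smul_mul_assoc, mul_smul_comm, mul_assoc]
  module
end
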